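/- Let π be a strongly Rayleigh probability distribution on the subsets of [N] that is k-homogeneous, i.e., π(S) > 0 only if |S| = k, where 0 < k < N. Consider the lazy Metropolis exchange chain on {S ⊆ [N] : |S| = k}: from state S, with probability 1/2 do nothing; otherwise choose s ∈ S and t ∈ [N]\S independently and uniformly at random and move to S∪{t}\{s} with probability min{1, π(S∪{t}\{s})/π(S)}, staying at S otherwise (the chain is restricted to the support of π). Then for every starting state X0 with π(X0) > 0 and every ε ∈ (0,1), the mixing time satisfies τ_{X0}(ε) ≤ 2k(N−k)·(log π(X0)^{-1} + log ε^{-1}). -/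

import Mathlib

open Finset
open scoped Classical

/-- Total variation distance between the `t`-step distribution of the chain with
transition matrix `P` started at `x0` and the distribution `μ`. -/
noncomputable def tvDist {Ω : Type*} [Fintype Ω] [DecidableEq Ω]
    (P : Matrix Ω Ω ℝ) (μ : Ω → ℝ) (x0 : Ω) (t : ℕ) : ℝ :=
  (1 / 2) * ∑ y, |(P ^ t) x0 y - μ y|

/-- Mixing time `τ_{x0}(ε)`. -/
noncomputable def mixingTime {Ω : Type*} [Fintype Ω] [DecidableEq Ω]
    (P : Matrix Ω Ω ℝ) (μ : Ω → ℝ) (x0 : Ω) (ε : ℝ) : ℕ :=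
  sInf {t : ℕ | ∀ t' ≥ t, tvDist P μ x0 t' ≤ ε}

/-- The generating polynomial of `π`, as a function of complex arguments. -/
noncomputable def genPoly {M : ℕ} (π : Finset (Fin M) → ℝ) (z : Fin M → ℂ) : ℂ :=
  ∑ S : Finset (Fin M), (π S : ℂ) * ∏ i ∈ S, z i

/-- A distribution on subsets of `[M]` is strongly Rayleigh if its generating polynomial
is real stable. -/
def StronglyRayleigh {M : ℕ} (π : Finset (Fin M) → ℝ) : Prop :=
  ∀ z : Fin M → ℂ, (∀ i, 0 < (z i).im) → genPoly π z ≠ 0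

section chain
variable {Ω : Type*} [Fintype Ω]

lemma chain_contr (P : Matrix Ω Ω ℝ) (μ : Ω → ℝ) (l : ℝ) (hl1 : l < 1)
    (hμ : ∀ x, 0 < μ x)
    (hrev : ∀ x y, μ x * P x y = μ y * P y x) (hrow : ∀ x, ∑ y, P x y = 1)
    (hnn : ∀ x y, 0 ≤ P x y) (hlazy : ∀ x, 1 / 2 ≤ P x x)
    (hgap : ∀ f : Ω → ℝ, ∑ x, μ x * f x = 0 →
      l * ∑ x, μ x * f x ^ 2 ≤ 1 / 2 * ∑ x, ∑ y, μ x * P x y * (f x - f y) ^ 2)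
    (g : Ω → ℝ) (hg : ∑ x, μ x * g x = 0) :
    (∑ x, μ x * (∑ y, P x y * g y) = 0) ∧
    ∑ x, μ x * (∑ y, P x y * g y) ^ 2 ≤ (1 - l) ^ 2 * ∑ x, μ x * g x ^ 2 := by
  have e1 : ∀ φ : Ω → ℝ, ∑ x, ∑ y, μ x * P x y * φ x = ∑ x, μ x * φ x := by
    intro φ
    refine Finset.sum_congr rfl fun x _ => ?_
    calc ∑ y, μ x * P x y * φ x = ∑ y, (μ x * φ x) * P x y :=
          Finset.sum_congr rfl fun y _ => by ring
      _ = μ x * φ x := by rw [← Finset.mul_sum, hrow, mul_one]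
  have e2 : ∀ φ : Ω → ℝ, ∑ x, ∑ y, μ x * P x y * φ y = ∑ x, μ x * φ x := by
    intro φ
    rw [Finset.sum_comm, ← e1 φ]
    refine Finset.sum_congr rfl fun x _ => Finset.sum_congr rfl fun y _ => ?_
    rw [hrev y x]
  set B : (Ω → ℝ) → (Ω → ℝ) → ℝ := fun f h => ∑ x, ∑ y, μ x * P x y * (f x * h y) with hB
  have Bsymm : ∀ f h, B f h = B h f := by
    intro f h
    simp only [hB]
    rw [Finset.sum_comm]
    refine Finset.sum_congr rfl fun x _ => Finset.sum_congr rfl fun y _ => ?_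
    rw [hrev y x]; ring
  have Bpos : ∀ f, 0 ≤ B f f := by
    intro f
    have h1 : ∑ x, ∑ y, μ x * P x y * (f x + f y) ^ 2 = 2 * ∑ x, μ x * f x ^ 2 + 2 * B f f := by
      have : ∑ x, ∑ y, μ x * P x y * (f x + f y) ^ 2 =
        ∑ x, ∑ y, μ x * P x y * (f x ^ 2) + ∑ x, ∑ y, μ x * P x y * (f y ^ 2) + 2 * B f f := by
        simp only [hB, Finset.mul_sum, ← Finset.sum_add_distrib]
        refine Finset.sum_congr rfl fun x _ => Finset.sum_congr rfl fun y _ => ?_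
        ring
      rw [this, e1 (fun x => f x ^ 2), e2 (fun x => f x ^ 2)]; ring
    have h2 : 2 * ∑ x, μ x * f x ^ 2 ≤ ∑ x, ∑ y, μ x * P x y * (f x + f y) ^ 2 := by
      rw [Finset.mul_sum]
      refine Finset.sum_le_sum fun x _ => ?_
      refine le_trans ?_ (Finset.single_le_sum (f := fun y => μ x * P x y * (f x + f y) ^ 2)
        (fun y _ => mul_nonneg (mul_nonneg (hμ x).le (hnn x y)) (sq_nonneg _)) (Finset.mem_univ x))
      have := mul_nonneg (mul_nonneg (hμ x).le (sub_nonneg.2 (hlazy x))) (sq_nonneg (f x))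
      nlinarith
    linarith
  have Ble : ∀ f, ∑ x, μ x * f x = 0 → B f f ≤ (1 - l) * ∑ x, μ x * f x ^ 2 := by
    intro f hf
    have h1 : ∑ x, ∑ y, μ x * P x y * (f x - f y) ^ 2 = 2 * ∑ x, μ x * f x ^ 2 - 2 * B f f := by
      have : ∑ x, ∑ y, μ x * P x y * (f x - f y) ^ 2 =
        ∑ x, ∑ y, μ x * P x y * (f x ^ 2) + ∑ x, ∑ y, μ x * P x y * (f y ^ 2) - 2 * B f f := by
        simp only [hB, Finset.mul_sum, ← Finset.sum_add_distrib, ← Finset.sum_sub_distrib]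
        refine Finset.sum_congr rfl fun x _ => Finset.sum_congr rfl fun y _ => ?_
        ring
      rw [this, e1 (fun x => f x ^ 2), e2 (fun x => f x ^ 2)]; ring
    have := hgap f hf
    rw [h1] at this
    linarith
  set h : Ω → ℝ := fun x => ∑ y, P x y * g y with hh
  have hh0 : ∑ x, μ x * h x = 0 := by
    rw [← hg, ← e2 g]
    refine Finset.sum_congr rfl fun x _ => ?_
    simp only [hh, Finset.mul_sum]
    exact Finset.sum_congr rfl fun y _ => by ring
  refine ⟨hh0, ?_⟩
  have hBh : ∀ f, B f g = ∑ x, μ x * (f x * h x) := by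
    intro f
    simp only [hB, hh, Finset.mul_sum]
    exact Finset.sum_congr rfl fun x _ => Finset.sum_congr rfl fun y _ => by ring
  have hBhg : B h g = ∑ x, μ x * h x ^ 2 := by
    rw [hBh]; exact Finset.sum_congr rfl fun x _ => by ring
  have hexp : B (fun x => (1 - l) * g x - h x) (fun x => (1 - l) * g x - h x)
      = (1 - l) ^ 2 * B g g - (1 - l) * B g h - (1 - l) * B h g + B h h := by
    simp only [hB, Finset.mul_sum, ← Finset.sum_add_distrib, ← Finset.sum_sub_distrib]
    exact Finset.sum_congr rfl fun x _ => Finset.sum_congr rfl fun y _ => by ring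
  have p1 := Bpos (fun x => (1 - l) * g x - h x)
  rw [hexp, Bsymm g h, hBhg] at p1
  have p2 := Ble h hh0
  have p3 := Ble g hg
  have c0 : 0 < 1 - l := by linarith
  have p4 : (1 - l) * (∑ x, μ x * h x ^ 2) ≤ (1 - l) * ((1 - l) ^ 2 * ∑ x, μ x * g x ^ 2) := by
    nlinarith [mul_le_mul_of_nonneg_left p3 (sq_nonneg (1 - l))]
  exact le_of_mul_le_mul_left p4 c0

lemma chain_tv [DecidableEq Ω] (P : Matrix Ω Ω ℝ) (μ : Ω → ℝ) (l : ℝ) (hl1 : l < 1)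
    (hμ : ∀ x, 0 < μ x) (hsum : ∑ x, μ x = 1)
    (hrev : ∀ x y, μ x * P x y = μ y * P y x) (hrow : ∀ x, ∑ y, P x y = 1)
    (hnn : ∀ x y, 0 ≤ P x y) (hlazy : ∀ x, 1 / 2 ≤ P x x)
    (hgap : ∀ f : Ω → ℝ, ∑ x, μ x * f x = 0 →
      l * ∑ x, μ x * f x ^ 2 ≤ 1 / 2 * ∑ x, ∑ y, μ x * P x y * (f x - f y) ^ 2)
    (x0 : Ω) (t : ℕ) :
    (∑ y, |(P ^ t) x0 y - μ y|) ^ 2 ≤ ((1 - l) ^ t) ^ 2 * (μ x0)⁻¹ := by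
  have key : ∀ t : ℕ, (∑ x, μ x * ((P ^ t) x0 x / μ x - 1) = 0) ∧
      ∑ x, μ x * ((P ^ t) x0 x / μ x - 1) ^ 2 ≤ ((1 - l) ^ t) ^ 2 * (μ x0)⁻¹ := by
    intro t
    induction t with
    | zero =>
      have hx : ∀ x, μ x * ((P ^ 0) x0 x / μ x - 1) = (if x0 = x then 1 else 0) - μ x := by
        intro x
        have := (hμ x).ne'
        rw [pow_zero, Matrix.one_apply]
        field_simp
      have hx2 : ∀ x, μ x * ((P ^ 0) x0 x / μ x - 1) ^ 2
          = (if x0 = x then (μ x)⁻¹ - 2 else 0) + μ x := by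
        intro x
        have := (hμ x).ne'
        rw [pow_zero, Matrix.one_apply]
        split_ifs <;> field_simp <;> ring
      constructor
      · simp only [hx, Finset.sum_sub_distrib, hsum]; simp
      · simp only [hx2, Finset.sum_add_distrib, hsum]; simp; linarith
    | succ t ih =>
      have hs : ∀ x, (P ^ (t + 1)) x0 x / μ x - 1 = ∑ y, P x y * ((P ^ t) x0 y / μ y - 1) := by
        intro x
        rw [pow_succ, Matrix.mul_apply]
        simp only [mul_sub, mul_one, Finset.sum_sub_distrib, hrow, Finset.sum_div]
        congr 1
        refine Finset.sum_congr rfl fun y _ => ?_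
        have h1 := (hμ x).ne'
        have h2 := (hμ y).ne'
        have := hrev x y
        field_simp
        linear_combination (-(P ^ t) x0 y) * this
      have := chain_contr P μ l hl1 hμ hrev hrow hnn hlazy hgap _ ih.1
      simp only [hs]
      refine ⟨this.1, this.2.trans ?_⟩
      calc _ ≤ (1 - l) ^ 2 * (((1 - l) ^ t) ^ 2 * (μ x0)⁻¹) :=
            mul_le_mul_of_nonneg_left ih.2 (sq_nonneg _)
        _ = _ := by ring
  refine le_trans ?_ (key t).2
  have hcs := Finset.sum_sq_le_sum_mul_sum_of_sq_le_mul Finset.univ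
    (r := fun y => |(P ^ t) x0 y - μ y|) (f := μ) (g := fun x => μ x * ((P ^ t) x0 x / μ x - 1) ^ 2)
    (fun y _ => (hμ y).le) (fun y _ => mul_nonneg (hμ y).le (sq_nonneg _)) (by
      intro y _
      have := (hμ y).ne'
      rw [sq_abs]; field_simp; exact le_rfl)
  rwa [hsum, one_mul] at hcs
end chain

lemma ms_sq (s : Multiset ℝ) : s.sum ^ 2 = (s.map (fun x => x ^ 2)).sum + 2 * s.esymm 2 := by
  induction s using Multiset.induction_on with
  | empty => simp [Multiset.esymm, Multiset.powersetCard_zero_right]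
  | cons a s ih =>
    have : (a ::ₘ s).esymm 2 = s.esymm 2 + a * s.sum := by
      simp [Multiset.esymm, Multiset.powersetCard_cons, Multiset.powersetCard_one,
        Multiset.map_map]
      have := Multiset.sum_map_mul_left (s := s) (a := a) (f := fun x : ℝ => x)
      simpa using this
    rw [this]; simp only [Multiset.sum_cons, Multiset.map_cons]; linear_combination ih

open Polynomial in
lemma newton_poly (F : ℝ[X]) (m : ℕ) (hd : F.natDegree = m + 2)
    (hr : ∀ z : ℂ, 0 < z.im → aeval z F ≠ 0) :
    2 * F.coeff (m + 2) * F.coeff m ≤ F.coeff (m + 1) ^ 2 := by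
  have hF : F ≠ 0 := by rintro rfl; simp at hd
  have hreal : ∀ z : ℂ, aeval z F = 0 → z.im = 0 := by
    intro z hz
    rcases lt_trichotomy z.im 0 with h | h | h
    · exfalso
      refine hr ((starRingEnd ℂ) z) (by simpa using h) ?_
      rw [Polynomial.aeval_conj, hz, map_zero]
    · exact h
    · exact absurd hz (hr z h)
  have hsp : F.Splits := by
    refine Polynomial.Splits.of_splits_map (algebraMap ℝ ℂ) (IsAlgClosed.splits _) ?_
    intro a ha
    have ha0 : aeval a F = 0 := by
      have := (Polynomial.mem_roots'.1 ha).2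
      rwa [Polynomial.IsRoot.def, Polynomial.eval_map_algebraMap] at this
    exact ⟨a.re, Complex.ext (by simp) (by simp [hreal a ha0])⟩
  have hcard : F.roots.card = F.natDegree := hsp.natDegree_eq_card_roots.symm
  have c0 := Polynomial.coeff_eq_esymm_roots_of_card hcard (k := m + 2) (by omega)
  have c1 := Polynomial.coeff_eq_esymm_roots_of_card hcard (k := m + 1) (by omega)
  have c2 := Polynomial.coeff_eq_esymm_roots_of_card hcard (k := m) (by omega)
  have n1 : F.natDegree - (m + 2) = 0 := by omega
  have n2 : F.natDegree - (m + 1) = 1 := by omega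
  have n3 : F.natDegree - m = 2 := by omega
  rw [n1] at c0; rw [n2] at c1; rw [n3] at c2
  have h1 : F.roots.esymm 1 = F.roots.sum := by
    simp [Multiset.esymm, Multiset.powersetCard_one, Multiset.map_map]
  have h0 : F.roots.esymm 0 = 1 := by simp [Multiset.esymm]
  have hsq := ms_sq F.roots
  have hnn : 0 ≤ (F.roots.map (fun x => x ^ 2)).sum := by
    apply Multiset.sum_nonneg
    intro x hx
    obtain ⟨y, _, rfl⟩ := Multiset.mem_map.1 hx
    positivity
  rw [c0, c1, c2, h1, h0]
  have := mul_nonneg (sq_nonneg F.leadingCoeff) hnn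
  nlinarith

section links
variable {N : ℕ}

noncomputable def upSum (φ : Finset (Fin N) → ℝ) (T : Finset (Fin N)) : ℝ :=
  ∑ S ∈ Finset.univ.filter (fun S => T ⊆ S), φ S

noncomputable def lVar (w f : Finset (Fin N) → ℝ) (T : Finset (Fin N)) : ℝ :=
  upSum (fun S => w S * f S ^ 2) T - (upSum (fun S => w S * f S) T) ^ 2 / upSum w T

lemma upSum_swap (φ : Finset (Fin N) → Fin N → ℝ) (T : Finset (Fin N)) :
    ∑ i ∈ Tᶜ, upSum (fun S => φ S i) (insert i T) =
      upSum (fun S => ∑ i ∈ S \ T, φ S i) T := by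
  unfold upSum
  apply Finset.sum_comm'
  intro i S
  simp only [Finset.mem_compl, Finset.mem_filter, Finset.mem_univ, true_and, Finset.mem_sdiff,
    Finset.insert_subset_iff]
  tauto

lemma upSum_congr {φ ψ : Finset (Fin N) → ℝ} {T : Finset (Fin N)}
    (h : ∀ S, T ⊆ S → φ S = ψ S) : upSum φ T = upSum ψ T :=
  Finset.sum_congr rfl fun S hS => h S (Finset.mem_filter.1 hS).2

lemma upSum_le {φ ψ : Finset (Fin N) → ℝ} {T : Finset (Fin N)}
    (h : ∀ S, T ⊆ S → φ S ≤ ψ S) : upSum φ T ≤ upSum ψ T :=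
  Finset.sum_le_sum fun S hS => h S (Finset.mem_filter.1 hS).2

lemma upSum_nonneg {φ : Finset (Fin N) → ℝ} {T : Finset (Fin N)}
    (h : ∀ S, T ⊆ S → 0 ≤ φ S) : 0 ≤ upSum φ T :=
  Finset.sum_nonneg fun S hS => h S (Finset.mem_filter.1 hS).2

lemma upSum_mul (c : ℝ) (φ : Finset (Fin N) → ℝ) (T : Finset (Fin N)) :
    upSum (fun S => c * φ S) T = c * upSum φ T := by
  unfold upSum; rw [Finset.mul_sum]

lemma upSum_add (φ ψ : Finset (Fin N) → ℝ) (T : Finset (Fin N)) :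
    upSum (fun S => φ S + ψ S) T = upSum φ T + upSum ψ T := by
  unfold upSum; rw [Finset.sum_add_distrib]

lemma upSum_sub (φ ψ : Finset (Fin N) → ℝ) (T : Finset (Fin N)) :
    upSum (fun S => φ S - ψ S) T = upSum φ T - upSum ψ T := by
  unfold upSum; rw [Finset.sum_sub_distrib]

lemma upSum_zero_w {w : Finset (Fin N) → ℝ} (hw : ∀ S, 0 ≤ w S) {T : Finset (Fin N)}
    (h : upSum w T = 0) {S : Finset (Fin N)} (hS : T ⊆ S) : w S = 0 :=
  (Finset.sum_eq_zero_iff_of_nonneg (fun S _ => hw S)).1 h S (by simpa using hS)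

lemma upSum_zero_mul {w : Finset (Fin N) → ℝ} (hw : ∀ S, 0 ≤ w S) {T : Finset (Fin N)}
    (h : upSum w T = 0) (f : Finset (Fin N) → ℝ) : upSum (fun S => w S * f S) T = 0 :=
  Finset.sum_eq_zero fun S hS => by
    rw [upSum_zero_w hw h (Finset.mem_filter.1 hS).2, zero_mul]

/-- Negative-correlation type inequality in each link. -/
def LinkNewton (w : Finset (Fin N) → ℝ) : Prop :=
  ∀ (T : Finset (Fin N)) (g : Fin N → ℝ),
    upSum w T * upSum (fun S => w S * ((∑ i ∈ S, g i) ^ 2 - ∑ i ∈ S, g i ^ 2)) T ≤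
      (upSum (fun S => w S * ∑ i ∈ S, g i) T) ^ 2

lemma sum_sdiff_card {w : Finset (Fin N) → ℝ} {k : ℕ} (hk : ∀ S, w S ≠ 0 → S.card = k)
    {T : Finset (Fin N)} {m : ℕ} (hT : T.card + m = k) (φ : Finset (Fin N) → ℝ) :
    ∑ i ∈ Tᶜ, upSum (fun S => w S * φ S) (insert i T) = m * upSum (fun S => w S * φ S) T := by
  rw [upSum_swap (fun S _ => w S * φ S), ← upSum_mul]
  refine upSum_congr fun S hS => ?_
  rw [Finset.sum_const, nsmul_eq_mul]
  by_cases h : w S = 0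
  · simp [h]
  · have := hk S h
    have h2 := Finset.card_sdiff_add_card_eq_card hS
    have : (S \ T).card = m := by omega
    rw [this]

lemma link_centered {w : Finset (Fin N) → ℝ} (hw : ∀ S, 0 ≤ w S) {k : ℕ}
    (hk : ∀ S, w S ≠ 0 → S.card = k) (hN : LinkNewton w)
    {T : Finset (Fin N)} {m : ℕ} (hT : T.card + m = k) (hW : 0 < upSum w T)
    (h : Finset (Fin N) → ℝ) (h0 : upSum (fun S => w S * h S) T = 0) :
    ∑ i ∈ Tᶜ, (upSum (fun S => w S * h S) (insert i T)) ^ 2 / upSum w (insert i T) ≤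
      upSum (fun S => w S * h S ^ 2) T := by
  set W : Fin N → ℝ := fun i => upSum w (insert i T) with hWd
  set H : Fin N → ℝ := fun i => upSum (fun S => w S * h S) (insert i T) with hHd
  set g : Fin N → ℝ := fun i => if i ∈ T then 0 else H i / W i with hg
  have hgW : ∀ i ∈ Tᶜ, g i * W i = H i := by
    intro i hi
    have hi' : i ∉ T := by simpa using hi
    simp only [hg, if_neg hi']
    by_cases hz : W i = 0
    · have : H i = 0 := upSum_zero_mul hw hz h
      rw [this, hz]; simp
    · field_simp
  have hX : ∀ (ψ : ℝ → ℝ), ψ 0 = 0 → ∀ S, T ⊆ S → ∑ i ∈ S \ T, ψ (g i) = ∑ i ∈ S, ψ (g i) := by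
    intro ψ hψ S hS
    rw [← Finset.sum_sdiff hS]
    have : ∑ i ∈ T, ψ (g i) = 0 := Finset.sum_eq_zero fun i hi => by simp [hg, hi, hψ]
    rw [this, add_zero]
  -- general identity
  have gen : ∀ (ψ : ℝ → ℝ), ψ 0 = 0 → ∀ φ : Finset (Fin N) → ℝ,
      ∑ i ∈ Tᶜ, ψ (g i) * upSum φ (insert i T) = upSum (fun S => φ S * ∑ i ∈ S, ψ (g i)) T := by
    intro ψ hψ φ
    calc ∑ i ∈ Tᶜ, ψ (g i) * upSum φ (insert i T)
        = ∑ i ∈ Tᶜ, upSum (fun S => ψ (g i) * φ S) (insert i T) :=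
          Finset.sum_congr rfl fun i _ => (upSum_mul _ _ _).symm
      _ = upSum (fun S => ∑ i ∈ S \ T, ψ (g i) * φ S) T :=
          upSum_swap (fun S i => ψ (g i) * φ S) T
      _ = _ := by
          refine upSum_congr fun S hS => ?_
          rw [← Finset.sum_mul, hX ψ hψ S hS, mul_comm]
  set A := ∑ i ∈ Tᶜ, H i ^ 2 / W i with hA
  have a1 : A = upSum (fun S => w S * h S * ∑ i ∈ S, g i) T := by
    rw [← gen (fun x => x) rfl]
    refine Finset.sum_congr rfl fun i hi => ?_
    have hi' : i ∉ T := by simpa using hi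
    change H i ^ 2 / W i = g i * H i
    simp only [hg, if_neg hi']; ring
  have a2 : A = upSum (fun S => w S * ∑ i ∈ S, g i ^ 2) T := by
    rw [← gen (fun x => x ^ 2) (by norm_num)]
    refine Finset.sum_congr rfl fun i hi => ?_
    have hi' : i ∉ T := by simpa using hi
    change H i ^ 2 / W i = g i ^ 2 * W i
    have e := hgW i hi
    have : g i ^ 2 * W i = g i * H i := by rw [← e]; ring
    rw [this]; simp only [hg, if_neg hi']; ring
  have a3 : upSum (fun S => w S * ∑ i ∈ S, g i) T = 0 := by
    rw [← gen (fun x => x) rfl, Finset.sum_congr rfl hgW, hHd, sum_sdiff_card hk hT, h0, mul_zero]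
  have a4 := hN T g
  rw [a3] at a4
  have a5 : upSum (fun S => w S * ((∑ i ∈ S, g i) ^ 2 - ∑ i ∈ S, g i ^ 2)) T =
      upSum (fun S => w S * (∑ i ∈ S, g i) ^ 2) T - A := by
    rw [a2, ← upSum_sub]; exact upSum_congr fun S _ => by ring
  rw [a5] at a4
  have a6 : upSum (fun S => w S * (∑ i ∈ S, g i) ^ 2) T - A ≤ 0 := by
    by_contra hc
    push Not at hc
    have := mul_pos hW hc
    linarith
  have a7 : 0 ≤ upSum (fun S => w S * (h S - ∑ i ∈ S, g i) ^ 2) T :=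
    upSum_nonneg fun S _ => mul_nonneg (hw S) (sq_nonneg _)
  have a8 : upSum (fun S => w S * (h S - ∑ i ∈ S, g i) ^ 2) T =
      upSum (fun S => w S * h S ^ 2) T - 2 * A + upSum (fun S => w S * (∑ i ∈ S, g i) ^ 2) T := by
    rw [a1, ← upSum_mul, ← upSum_sub, ← upSum_add]; exact upSum_congr fun S _ => by ring
  linarith

lemma link_step {w : Finset (Fin N) → ℝ} (hw : ∀ S, 0 ≤ w S) {k : ℕ}
    (hk : ∀ S, w S ≠ 0 → S.card = k) (hN : LinkNewton w)
    {T : Finset (Fin N)} {m : ℕ} (hT : T.card + m = k) (f : Finset (Fin N) → ℝ) :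
    ∑ i ∈ Tᶜ, (upSum (fun S => w S * f S) (insert i T)) ^ 2 / upSum w (insert i T)
      - m * ((upSum (fun S => w S * f S) T) ^ 2 / upSum w T) ≤ lVar w f T := by
  by_cases hz : upSum w T = 0
  · have h1 : lVar w f T = 0 := by
      simp only [lVar, hz, upSum_zero_mul hw hz, div_zero, sub_zero]
    have h2 : ∀ i, upSum (fun S => w S * f S) (insert i T) = 0 := by
      intro i
      refine Finset.sum_eq_zero fun S hS => ?_
      rw [upSum_zero_w hw hz ((Finset.subset_insert i T).trans (Finset.mem_filter.1 hS).2),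
        zero_mul]
    simp [h1, h2, hz]
  have hW : 0 < upSum w T := lt_of_le_of_ne (upSum_nonneg fun S _ => hw S) (Ne.symm hz)
  set c := upSum (fun S => w S * f S) T / upSum w T with hc
  have sh : ∀ R, upSum (fun S => w S * (f S - c)) R = upSum (fun S => w S * f S) R - c * upSum w R := by
    intro R
    rw [← upSum_mul, ← upSum_sub]; exact upSum_congr fun S _ => by ring
  have h0 : upSum (fun S => w S * (f S - c)) T = 0 := by
    rw [sh, hc]; field_simp; ring
  have main := link_centered hw hk hN hT hW (fun S => f S - c) h0
  have e1 : upSum (fun S => w S * (f S - c) ^ 2) T = lVar w f T := by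
    have : upSum (fun S => w S * (f S - c) ^ 2) T = upSum (fun S => w S * f S ^ 2) T
        - 2 * c * upSum (fun S => w S * f S) T + c ^ 2 * upSum w T := by
      rw [← upSum_mul, ← upSum_mul, ← upSum_sub, ← upSum_add]; exact upSum_congr fun S _ => by ring
    rw [this, lVar, hc]; field_simp; ring
  have e2 : ∑ i ∈ Tᶜ, (upSum (fun S => w S * (f S - c)) (insert i T)) ^ 2 / upSum w (insert i T)
      = ∑ i ∈ Tᶜ, (upSum (fun S => w S * f S) (insert i T)) ^ 2 / upSum w (insert i T)
       - m * ((upSum (fun S => w S * f S) T) ^ 2 / upSum w T) := by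
    have t1 := sum_sdiff_card hk hT f
    have t2 := sum_sdiff_card hk hT (fun _ => 1)
    simp only [mul_one] at t2
    have : ∀ i ∈ Tᶜ, (upSum (fun S => w S * (f S - c)) (insert i T)) ^ 2 / upSum w (insert i T)
      = (upSum (fun S => w S * f S) (insert i T)) ^ 2 / upSum w (insert i T)
        - 2 * c * upSum (fun S => w S * f S) (insert i T) + c ^ 2 * upSum w (insert i T) := by
      intro i _
      rw [sh]
      by_cases hzi : upSum w (insert i T) = 0
      · rw [upSum_zero_mul hw hzi, hzi]; simp
      · field_simp; ring
    rw [Finset.sum_congr rfl this, Finset.sum_add_distrib, Finset.sum_sub_distrib,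
      ← Finset.mul_sum, ← Finset.mul_sum, t1]
    rw [show ∑ i ∈ Tᶜ, upSum w (insert i T) = m * upSum w T from t2, hc]
    field_simp; ring
  rw [e1] at main
  rw [← e2]; exact main

lemma link_var {w : Finset (Fin N) → ℝ} (hw : ∀ S, 0 ≤ w S) {k : ℕ}
    (hk : ∀ S, w S ≠ 0 → S.card = k) (hN : LinkNewton w) (f : Finset (Fin N) → ℝ) (m : ℕ) :
    ∀ T : Finset (Fin N), T.card + (m + 1) = k →
    lVar w f T ≤ upSum (fun R => if R.card + 1 = k then lVar w f R else 0) T := by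
  induction m with
  | zero =>
    intro T hT
    apply le_of_eq
    unfold upSum
    rw [Finset.sum_eq_single T]
    · simp at hT; simp [hT]
    · intro R hR hne
      rw [if_neg]
      intro hc
      exact hne (Finset.eq_of_subset_of_card_le (Finset.mem_filter.1 hR).2 (by omega)).symm
    · intro h; simp at h
  | succ m ih =>
    intro T hT
    have s1 := link_step hw hk hN hT f
    have s2 := sum_sdiff_card hk hT (fun S => f S ^ 2)
    have s3 : ∑ i ∈ Tᶜ, lVar w f (insert i T) ≤
        ∑ i ∈ Tᶜ, upSum (fun R => if R.card + 1 = k then lVar w f R else 0) (insert i T) := by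
      refine Finset.sum_le_sum fun i hi => ih _ ?_
      rw [Finset.card_insert_of_notMem (by simpa using hi)]; omega
    rw [upSum_swap (fun R _ => if R.card + 1 = k then lVar w f R else 0)] at s3
    have s4 : upSum (fun R => ∑ i ∈ R \ T, if R.card + 1 = k then lVar w f R else 0) T
        = ((m + 1 : ℕ) : ℝ) * upSum (fun R => if R.card + 1 = k then lVar w f R else 0) T := by
      rw [← upSum_mul]
      refine upSum_congr fun R hR => ?_
      rw [Finset.sum_const, nsmul_eq_mul]
      by_cases h : R.card + 1 = k
      · have h2 := Finset.card_sdiff_add_card_eq_card hR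
        have : (R \ T).card = m + 1 := by omega
        rw [this]
      · simp [h]
    rw [s4] at s3
    have s5 : ∑ i ∈ Tᶜ, lVar w f (insert i T) = ((m + 1 + 1 : ℕ) : ℝ) * upSum (fun S => w S * f S ^ 2) T
       - ∑ i ∈ Tᶜ, (upSum (fun S => w S * f S) (insert i T)) ^ 2 / upSum w (insert i T) := by
      rw [← s2, ← Finset.sum_sub_distrib]; rfl
    have s6 : lVar w f T = upSum (fun S => w S * f S ^ 2) T
      - (upSum (fun S => w S * f S) T) ^ 2 / upSum w T := rfl
    have s7 : ((m + 1 : ℕ) : ℝ) * lVar w f T ≤ ((m + 1 : ℕ) : ℝ) *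
        upSum (fun R => if R.card + 1 = k then lVar w f R else 0) T := by
      push_cast at *
      rw [s5] at s3
      have : ((m : ℝ) + 1 + 1) * lVar w f T = ((m : ℝ) + 1 + 1) * upSum (fun S => w S * f S ^ 2) T
        - ((m : ℝ) + 1 + 1) * ((upSum (fun S => w S * f S) T) ^ 2 / upSum w T) := by
        rw [s6]; ring
      linarith
    exact le_of_mul_le_mul_left s7 (by positivity)

lemma lVar_le {w : Finset (Fin N) → ℝ} (hw : ∀ S, 0 ≤ w S) (f : Finset (Fin N) → ℝ)
    (R : Finset (Fin N)) :
    lVar w f R ≤ 1 / 2 * upSum (fun S => upSum (fun S' => min (w S) (w S') * (f S - f S') ^ 2) R) R := by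
  by_cases hz : upSum w R = 0
  · have h1 : lVar w f R = 0 := by
      simp only [lVar, hz, upSum_zero_mul hw hz, div_zero, sub_zero]
    rw [h1]
    refine mul_nonneg (by norm_num) (upSum_nonneg fun S _ => upSum_nonneg fun S' _ => ?_)
    exact mul_nonneg (le_min (hw _) (hw _)) (sq_nonneg _)
  have hW : 0 < upSum w R := lt_of_le_of_ne (upSum_nonneg fun S _ => hw S) (Ne.symm hz)
  have e1 : upSum (fun S => upSum (fun S' => w S * w S' * (f S - f S') ^ 2) R) R
      = 2 * upSum w R * upSum (fun S => w S * f S ^ 2) R - 2 * (upSum (fun S => w S * f S) R) ^ 2 := by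
    have : ∀ S, upSum (fun S' => w S * w S' * (f S - f S') ^ 2) R =
      (upSum w R) * (w S * f S ^ 2) - 2 * upSum (fun S => w S * f S) R * (w S * f S)
        + upSum (fun S => w S * f S ^ 2) R * w S := by
      intro S
      have : upSum (fun S' => w S * w S' * (f S - f S') ^ 2) R =
        (w S * f S ^ 2) * (upSum w R) - (2 * (w S * f S)) * upSum (fun S => w S * f S) R
        + w S * upSum (fun S => w S * f S ^ 2) R := by
        rw [← upSum_mul, ← upSum_mul, ← upSum_mul, ← upSum_sub, ← upSum_add]
        exact upSum_congr fun S _ => by ring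
      rw [this]; ring
    simp only [this]
    rw [upSum_add, upSum_sub, upSum_mul, upSum_mul, upSum_mul]; ring
  have e2 : upSum (fun S => upSum (fun S' => w S * w S' * (f S - f S') ^ 2) R) R ≤
     upSum w R * upSum (fun S => upSum (fun S' => min (w S) (w S') * (f S - f S') ^ 2) R) R := by
    rw [← upSum_mul]
    refine upSum_le fun S hS => ?_
    rw [← upSum_mul]
    refine upSum_le fun S' hS' => ?_
    have hle : ∀ S, R ⊆ S → w S ≤ upSum w R := fun S hS =>
      Finset.single_le_sum (f := w) (fun S _ => hw S) (by simpa using hS)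
    rw [← mul_assoc]
    refine mul_le_mul_of_nonneg_right ?_ (sq_nonneg _)
    rw [← max_mul_min (w S) (w S')]
    exact mul_le_mul_of_nonneg_right (max_le (hle S hS) (hle S' hS')) (le_min (hw _) (hw _))
  rw [e1] at e2
  have : upSum w R * lVar w f R = upSum w R * upSum (fun S => w S * f S ^ 2) R
      - (upSum (fun S => w S * f S) R) ^ 2 := by
    rw [lVar]; field_simp
  refine le_of_mul_le_mul_left ?_ hW
  rw [this]; linarith

lemma poincare {w : Finset (Fin N) → ℝ} (hw : ∀ S, 0 ≤ w S) {k : ℕ} (hk0 : 0 < k)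
    (hk : ∀ S, w S ≠ 0 → S.card = k) (hN : LinkNewton w) (hsum : ∑ S, w S = 1)
    (f : Finset (Fin N) → ℝ) (hf : ∑ S, w S * f S = 0) :
    ∑ S, w S * f S ^ 2 ≤ 1 / 2 * ∑ S, ∑ S',
      if (symmDiff S S').card = 2 then min (w S) (w S') * (f S - f S') ^ 2 else 0 := by
  have up0 : ∀ φ : Finset (Fin N) → ℝ, upSum φ ∅ = ∑ S, φ S := by
    intro φ; simp [upSum]
  have h1 := link_var hw hk hN f (k - 1) ∅ (by simp; omega)
  have h2 : lVar w f ∅ = ∑ S, w S * f S ^ 2 := by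
    rw [lVar, up0, up0, up0, hf, hsum]; simp
  rw [h2, up0] at h1
  refine h1.trans ?_
  have h3 : ∑ R : Finset (Fin N), (if R.card + 1 = k then lVar w f R else 0) ≤
    ∑ R : Finset (Fin N), 1 / 2 * ∑ S, ∑ S', if R.card + 1 = k ∧ R ⊆ S ∧ R ⊆ S' then
        min (w S) (w S') * (f S - f S') ^ 2 else 0 := by
    refine Finset.sum_le_sum fun R _ => ?_
    by_cases hR : R.card + 1 = k
    · rw [if_pos hR]
      refine (lVar_le hw f R).trans (le_of_eq ?_)
      congr 1
      unfold upSum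
      rw [Finset.sum_filter]
      refine Finset.sum_congr rfl fun S _ => ?_
      by_cases hS : R ⊆ S
      · rw [if_pos hS, Finset.sum_filter]
        refine Finset.sum_congr rfl fun S' _ => ?_
        simp [hR, hS]
      · simp [hS]
    · simp [hR]
  refine h3.trans ?_
  rw [← Finset.mul_sum]
  refine mul_le_mul_of_nonneg_left ?_ (by norm_num)
  rw [Finset.sum_comm]
  refine Finset.sum_le_sum fun S _ => ?_
  rw [Finset.sum_comm]
  refine Finset.sum_le_sum fun S' _ => ?_
  have nn : 0 ≤ min (w S) (w S') * (f S - f S') ^ 2 :=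
    mul_nonneg (le_min (hw _) (hw _)) (sq_nonneg _)
  by_cases hz : min (w S) (w S') * (f S - f S') ^ 2 = 0
  · simp [hz]
  have hne : S ≠ S' := by rintro rfl; simp at hz
  have hwS : w S ≠ 0 := by
    intro h; apply hz; rw [h, min_eq_left (hw _)]; simp
  have hwS' : w S' ≠ 0 := by
    intro h; apply hz; rw [h, min_eq_right (hw _)]; simp
  have cS := hk S hwS
  have cS' := hk S' hwS'
  have hint : ∀ R : Finset (Fin N), R.card + 1 = k → R ⊆ S → R ⊆ S' → R = S ∩ S' := by
    intro R h1 h2 h3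
    refine Finset.eq_of_subset_of_card_le (Finset.subset_inter h2 h3) ?_
    have : (S ∩ S').card < S.card := by
      apply Finset.card_lt_card
      refine (Finset.inter_subset_left).ssubset_of_ne fun h => hne ?_
      exact Finset.eq_of_subset_of_card_le (Finset.inter_eq_left.1 h) (by omega)
    omega
  calc _ ≤ ∑ R : Finset (Fin N), (if R = S ∩ S' then (if (symmDiff S S').card = 2 then
          min (w S) (w S') * (f S - f S') ^ 2 else 0) else 0) := by
        refine Finset.sum_le_sum fun R _ => ?_
        by_cases hR : R.card + 1 = k ∧ R ⊆ S ∧ R ⊆ S'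
        · have hRe := hint R hR.1 hR.2.1 hR.2.2
          have hc : (symmDiff S S').card = 2 := by
            have a1 := Finset.card_sdiff_add_card_inter S S'
            have a2 := Finset.card_sdiff_add_card_inter S' S
            rw [Finset.inter_comm S' S] at a2
            rw [symmDiff_def, Finset.sup_eq_union, Finset.card_union_of_disjoint disjoint_sdiff_sdiff]
            rw [← hRe] at a1 a2
            omega
          rw [if_pos hR, if_pos hRe, if_pos hc]
        · rw [if_neg hR]
          split_ifs <;> first | exact nn | exact le_rfl
    _ = _ := by simp
end links

section rayleigh
variable {N : ℕ}

open Polynomial in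
lemma newton_field {k : ℕ} (π : Finset (Fin N) → ℝ) (hπ : ∀ S, 0 ≤ π S)
    (hhom : ∀ S, π S ≠ 0 → S.card = k) (hSR : StronglyRayleigh π)
    (l : Fin N → ℝ) (hl : ∀ i, 0 < l i) (g : Fin N → ℝ) :
    (∑ S, π S * ∏ i ∈ S, l i) * (∑ S, (π S * ∏ i ∈ S, l i) * ((∑ i ∈ S, g i) ^ 2 - ∑ i ∈ S, g i ^ 2)) ≤
      (∑ S, (π S * ∏ i ∈ S, l i) * ∑ i ∈ S, g i) ^ 2 := by
  set w : Finset (Fin N) → ℝ := fun S => π S * ∏ i ∈ S, l i with hw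
  have hwk : ∀ S, w S ≠ 0 → S.card = k := fun S h => hhom S (left_ne_zero_of_mul h)
  have hsq : ∀ S : Finset (Fin N), (∑ i ∈ S, g i) ^ 2 - ∑ i ∈ S, g i ^ 2 =
      2 * (S.val.map g).esymm 2 := by
    intro S
    have := ms_sq (S.val.map g)
    rw [Multiset.map_map] at this
    have e : (∑ i ∈ S, g i) ^ 2 = ∑ i ∈ S, g i ^ 2 + 2 * (S.val.map g).esymm 2 := this
    linarith
  by_cases hW : ∑ S, w S = 0
  · change (∑ S, w S) * _ ≤ _
    rw [hW, zero_mul]; positivity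
  rcases Nat.lt_or_ge k 2 with hk | hk
  · have : ∑ S, w S * ((∑ i ∈ S, g i) ^ 2 - ∑ i ∈ S, g i ^ 2) = 0 := by
      refine Finset.sum_eq_zero fun S _ => ?_
      by_cases h : w S = 0
      · rw [h, zero_mul]
      · have hc := hwk S h
        rw [hsq S]
        have : (S.val.map g).esymm 2 = 0 := by
          unfold Multiset.esymm
          rw [Multiset.powersetCard_eq_empty]
          · simp
          · simp; omega
        rw [this]; ring
    change (∑ S, w S) * ∑ S, w S * ((∑ i ∈ S, g i) ^ 2 - ∑ i ∈ S, g i ^ 2) ≤ _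
    rw [this, mul_zero]; positivity
  obtain ⟨m, rfl⟩ := Nat.exists_eq_add_of_le' hk
  set F : ℝ[X] := ∑ S, C (w S) * (S.val.map fun i => X + C (g i)).prod with hF
  have hco : ∀ j ≤ m + 2, F.coeff j = ∑ S, w S * (S.val.map g).esymm (m + 2 - j) := by
    intro j hj
    rw [hF, Polynomial.finsetSum_coeff]
    refine Finset.sum_congr rfl fun S _ => ?_
    rw [Polynomial.coeff_C_mul]
    by_cases h : w S = 0
    · rw [h, zero_mul, zero_mul]
    · have hc := hwk S h
      rw [Multiset.prod_X_add_C_coeff' _ _ (by simpa [hc] using hj)]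
      simp [hc]
  have c0 : F.coeff (m + 2) = ∑ S, w S := by
    rw [hco _ le_rfl]; simp [Multiset.esymm]
  have c1 : F.coeff (m + 1) = ∑ S, w S * ∑ i ∈ S, g i := by
    rw [hco _ (by omega), show m + 2 - (m + 1) = 1 by omega]
    refine Finset.sum_congr rfl fun S _ => ?_
    simp [Multiset.esymm, Multiset.powersetCard_one, Multiset.map_map]
  have c2 : 2 * F.coeff m = ∑ S, w S * ((∑ i ∈ S, g i) ^ 2 - ∑ i ∈ S, g i ^ 2) := by
    rw [hco _ (by omega), show m + 2 - m = 2 by omega, Finset.mul_sum]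
    refine Finset.sum_congr rfl fun S _ => ?_
    rw [hsq]; ring
  have hdeg : F.natDegree = m + 2 := by
    refine Polynomial.natDegree_eq_of_le_of_coeff_ne_zero ?_ (by rw [c0]; exact hW)
    refine Polynomial.natDegree_sum_le_of_forall_le _ _ fun S _ => ?_
    by_cases h : w S = 0
    · simp [h]
    · refine (Polynomial.natDegree_C_mul_le _ _).trans ?_
      rw [← hwk S h]
      have := Polynomial.natDegree_multiset_prod_X_sub_C_eq_card (S.val.map fun i => - g i)
      simp only [Multiset.map_map, Function.comp_def, map_neg, sub_neg_eq_add] at this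
      rw [this]; simp
  have main := newton_poly F m hdeg ?_
  · rw [c0, c1] at main
    change (∑ S, w S) * ∑ S, w S * ((∑ i ∈ S, g i) ^ 2 - ∑ i ∈ S, g i ^ 2) ≤
      (∑ S, w S * ∑ i ∈ S, g i) ^ 2
    rw [← c2]; linarith
  · intro z hz
    have := hSR (fun i => (l i : ℂ) * (z + g i)) (fun i => by
      simp; exact mul_pos (hl i) hz)
    convert this using 1
    rw [hF, map_sum, genPoly]
    refine Finset.sum_congr rfl fun S _ => ?_
    change aeval z (C (w S) * ∏ i ∈ S, (X + C (g i))) = _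
    rw [Finset.prod_mul_distrib]
    simp [hw, mul_assoc]

lemma linkNewton_of_SR {k : ℕ} (π : Finset (Fin N) → ℝ) (hπ : ∀ S, 0 ≤ π S)
    (hhom : ∀ S, π S ≠ 0 → S.card = k) (hSR : StronglyRayleigh π) : LinkNewton π := by
  intro T g
  -- the perturbed inequality
  have key : ∀ d : ℝ, 0 < d →
      (∑ S, π S * d ^ (T \ S).card) *
        (∑ S, (π S * d ^ (T \ S).card) * ((∑ i ∈ S, g i) ^ 2 - ∑ i ∈ S, g i ^ 2)) ≤
      (∑ S, (π S * d ^ (T \ S).card) * ∑ i ∈ S, g i) ^ 2 := by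
    intro d hd
    have h := newton_field π hπ hhom hSR (fun i => if i ∈ T then d⁻¹ else 1)
      (fun i => by split_ifs <;> positivity) g
    have e : ∀ S : Finset (Fin N), d ^ (T \ S).card =
        d ^ T.card * ∏ i ∈ S, (if i ∈ T then d⁻¹ else 1) := by
      intro S
      rw [Finset.prod_ite, Finset.prod_const, Finset.prod_const_one, mul_one,
        Finset.filter_mem_eq_inter, ← Finset.card_sdiff_add_card_inter T S, pow_add,
        Finset.inter_comm S T, mul_assoc, ← mul_pow, mul_inv_cancel₀ hd.ne', one_pow, mul_one]
    have r : ∀ φ : Finset (Fin N) → ℝ, ∑ S, (π S * d ^ (T \ S).card) * φ S =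
        d ^ T.card * ∑ S, (π S * ∏ i ∈ S, (if i ∈ T then d⁻¹ else 1)) * φ S := by
      intro φ
      rw [Finset.mul_sum]
      exact Finset.sum_congr rfl fun S _ => by rw [e S]; ring
    have r1 := r (fun _ => 1)
    simp only [mul_one] at r1
    rw [r, r, r1]
    have := mul_le_mul_of_nonneg_left h (sq_nonneg (d ^ T.card))
    nlinarith
  have lim : ∀ φ : Finset (Fin N) → ℝ,
      Filter.Tendsto (fun d : ℝ => ∑ S, (π S * d ^ (T \ S).card) * φ S)
        (nhdsWithin 0 (Set.Ioi 0)) (nhds (upSum (fun S => π S * φ S) T)) := by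
    intro φ
    have hc : Continuous (fun d : ℝ => ∑ S, (π S * d ^ (T \ S).card) * φ S) := by fun_prop
    have := (hc.tendsto 0).mono_left (nhdsWithin_le_nhds (s := Set.Ioi 0))
    convert this using 2
    rw [upSum, Finset.sum_filter]
    refine Finset.sum_congr rfl fun S _ => ?_
    by_cases hS : T ⊆ S
    · simp [hS, Finset.sdiff_eq_empty_iff_subset.2 hS]
    · have : (T \ S).card ≠ 0 := by
        rw [Ne, Finset.card_eq_zero, Finset.sdiff_eq_empty_iff_subset]; exact hS
      simp [hS, zero_pow this]
  have l1 := lim (fun _ => 1)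
  simp only [mul_one] at l1
  refine le_of_tendsto_of_tendsto (l1.mul (lim _)) ((lim _).pow 2) ?_
  filter_upwards [self_mem_nhdsWithin] with d hd
  exact key d hd

lemma card_neighbors {k : ℕ} (S : Finset (Fin N)) (hS : S.card = k) :
    (Finset.univ.filter (fun T : Finset (Fin N) => T.card = k ∧ (symmDiff S T).card = 2)).card
      ≤ k * (N - k) := by
  have hcard : (S ×ˢ Sᶜ).card = k * (N - k) := by
    rw [Finset.card_product, Finset.card_compl, hS, Fintype.card_fin]
  rw [← hcard]
  refine (Finset.card_le_card (t := (S ×ˢ Sᶜ).image (fun p => insert p.2 (S.erase p.1))) ?_).trans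
    Finset.card_image_le
  intro T hT
  simp only [Finset.mem_filter, Finset.mem_univ, true_and] at hT
  obtain ⟨hT1, hT2⟩ := hT
  rw [symmDiff_def, Finset.sup_eq_union, Finset.card_union_of_disjoint disjoint_sdiff_sdiff] at hT2
  have a1 := Finset.card_sdiff_add_card_inter S T
  have a2 := Finset.card_sdiff_add_card_inter T S
  rw [Finset.inter_comm T S] at a2
  obtain ⟨a, ha⟩ := Finset.card_eq_one.1 (show (S \ T).card = 1 by omega)
  obtain ⟨b, hb⟩ := Finset.card_eq_one.1 (show (T \ S).card = 1 by omega)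
  have ha' : ∀ x, (x ∈ S ∧ x ∉ T) ↔ x = a := fun x => by
    rw [← Finset.mem_sdiff, ha, Finset.mem_singleton]
  have hb' : ∀ x, (x ∈ T ∧ x ∉ S) ↔ x = b := fun x => by
    rw [← Finset.mem_sdiff, hb, Finset.mem_singleton]
  refine Finset.mem_image.2 ⟨(a, b), ?_, ?_⟩
  · simp only [Finset.mem_product, Finset.mem_compl]
    exact ⟨((ha' a).2 rfl).1, ((hb' b).2 rfl).2⟩
  · ext x
    simp only [Finset.mem_insert, Finset.mem_erase]
    have h1 := ha' x
    have h2 := hb' x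
    tauto
end rayleigh

lemma final_bound (K p ε l s : ℝ) (t : ℕ) (hK : 2 ≤ K) (hl : l = 1 / K) (hp : 0 < p) (hp1 : p ≤ 1)
    (hε : 0 < ε) (hs : 0 ≤ s) (ht : K * (Real.log p⁻¹ + Real.log ε⁻¹) < t + 1)
    (hsq : s ^ 2 ≤ ((1 - l) ^ t) ^ 2 * p⁻¹) : 1 / 2 * s ≤ ε := by
  have hK0 : 0 < K := by linarith
  have hl2 : l ≤ 1 / 2 := by rw [hl]; exact one_div_le_one_div_of_le (by norm_num) hK
  have hl0 : 0 < l := by rw [hl]; positivity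
  have h1 : (1 - l) ^ t ≤ 2 * (p * ε) := by
    have e1 : (1 - l) ^ t ≤ Real.exp (-l) ^ t := by
      refine pow_le_pow_left₀ (by linarith) ?_ t
      have := Real.add_one_le_exp (-l); linarith
    rw [← Real.exp_nat_mul] at e1
    have e2 : (t : ℝ) * -l ≤ 1 / 2 + (Real.log p + Real.log ε) := by
      rw [Real.log_inv, Real.log_inv] at ht
      have h := mul_le_mul_of_nonneg_left ht.le hl0.le
      have hlK : l * K = 1 := by rw [hl]; field_simp
      rw [← mul_assoc, hlK] at h
      linarith
    have e3 := Real.exp_le_exp.2 e2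
    rw [Real.exp_add, Real.exp_add, Real.exp_log hp, Real.exp_log hε] at e3
    have e4 : Real.exp (1 / 2) ≤ 2 := by
      have h := Real.exp_one_lt_d9
      have : Real.exp (1 / 2) ^ 2 = Real.exp 1 := by
        rw [← Real.exp_nat_mul]; norm_num
      nlinarith [Real.exp_pos (1 / 2 : ℝ)]
    exact e1.trans (e3.trans (mul_le_mul_of_nonneg_right e4 (by positivity)))
  have h2 : s ^ 2 ≤ (2 * ε) ^ 2 := by
    have h0 : 0 ≤ (1 - l) ^ t := pow_nonneg (by linarith) t
    calc s ^ 2 ≤ ((1 - l) ^ t) ^ 2 * p⁻¹ := hsq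
      _ ≤ (2 * (p * ε)) ^ 2 * p⁻¹ := by gcongr
      _ = (2 * ε) ^ 2 * p := by field_simp
      _ ≤ (2 * ε) ^ 2 := mul_le_of_le_one_right (by positivity) hp1
  have := abs_le_of_sq_le_sq h2 (by positivity)
  linarith [le_abs_self s]

/-- Anari–Oveis Gharan–Rezaei: fast mixing of the lazy Metropolis
exchange chain for a `k`-homogeneous strongly Rayleigh distribution, restricted to the
support of `π`. -/
theorem mixing_time_exchange_chain_homogeneous_stronglyRayleigh
    (N k : ℕ) (hk : 0 < k) (hkN : k < N)
    (π : Finset (Fin N) → ℝ)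
    (hπ_nonneg : ∀ S, 0 ≤ π S) (hπ_sum : ∑ S : Finset (Fin N), π S = 1)
    (hhom : ∀ S : Finset (Fin N), 0 < π S → S.card = k)
    (hSR : StronglyRayleigh π)
    -- the lazy Metropolis exchange chain on the support of `π`
    (P : Matrix {S : Finset (Fin N) // S.card = k ∧ 0 < π S}
      {S : Finset (Fin N) // S.card = k ∧ 0 < π S} ℝ)
    (hPoff : ∀ S T : {S : Finset (Fin N) // S.card = k ∧ 0 < π S}, S ≠ T →
      P S T = if (symmDiff S.val T.val).card = 2 then
        (1 / (2 * (k : ℝ) * ((N : ℝ) - k))) * min 1 (π T.val / π S.val)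
      else 0)
    (hPdiag : ∀ S : {S : Finset (Fin N) // S.card = k ∧ 0 < π S},
      P S S = 1 - ∑ T ∈ Finset.univ.erase S, P S T)
    (X0 : {S : Finset (Fin N) // S.card = k ∧ 0 < π S})
    (ε : ℝ) (hε : ε ∈ Set.Ioo (0 : ℝ) 1) :
    (mixingTime P (fun S => π S.val) X0 ε : ℝ) ≤
      2 * (k : ℝ) * ((N : ℝ) - k) *
        (Real.log (π X0.val)⁻¹ + Real.log ε⁻¹) := by
  have hk1 : (1 : ℝ) ≤ k := by exact_mod_cast hk
  have hNk : (1 : ℝ) ≤ (N : ℝ) - k := by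
    have : ((k + 1 : ℕ) : ℝ) ≤ N := by exact_mod_cast hkN
    push_cast at this; linarith
  set K : ℝ := 2 * (k : ℝ) * ((N : ℝ) - k) with hK
  have hK2 : 2 ≤ K := by rw [hK]; nlinarith
  have hK0 : 0 < K := by linarith
  have hhom' : ∀ S, π S ≠ 0 → S.card = k := fun S h =>
    hhom S (lt_of_le_of_ne (hπ_nonneg S) (Ne.symm h))
  have hLN := linkNewton_of_SR π hπ_nonneg hhom' hSR
  -- sums over the support
  have hsupp : ∀ φ : Finset (Fin N) → ℝ, (∀ S, π S = 0 → φ S = 0) →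
      ∑ S : {S : Finset (Fin N) // S.card = k ∧ 0 < π S}, φ S.val = ∑ S, φ S := by
    intro φ hφ
    rw [← Finset.sum_subtype (Finset.univ.filter fun S => S.card = k ∧ 0 < π S) (by simp) φ]
    refine Finset.sum_subset (Finset.subset_univ _) fun S _ hS => hφ S ?_
    by_contra hne
    exact hS (by simpa using ⟨hhom' S hne, lt_of_le_of_ne (hπ_nonneg S) (Ne.symm hne)⟩)
  have hoff : ∀ S T : {S : Finset (Fin N) // S.card = k ∧ 0 < π S},
      S ≠ T → π S.val * P S T = if (symmDiff S.val T.val).card = 2 then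
        (1 / K) * min (π S.val) (π T.val) else 0 := by
    intro S T hST
    rw [hPoff S T hST]
    split_ifs
    · have h := S.2.2
      have : min (π S.val) (π T.val) = π S.val * min 1 (π T.val / π S.val) := by
        rw [mul_min_of_nonneg _ _ h.le, mul_one, mul_div_cancel₀ _ h.ne']
      rw [this]; ring
    · simp
  have hnnoff : ∀ S T : {S : Finset (Fin N) // S.card = k ∧ 0 < π S}, S ≠ T → 0 ≤ P S T := by
    intro S T hST
    rw [hPoff S T hST]
    split_ifs
    · have h1 := S.2.2
      have h2 := T.2.2
      positivity
    · exact le_rfl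
  have hlazy : ∀ S, 1 / 2 ≤ P S S := by
    intro S
    have h1 : ∑ T ∈ Finset.univ.erase S, P S T ≤ ∑ T : {S : Finset (Fin N) // S.card = k ∧ 0 < π S},
        if (symmDiff S.val T.val).card = 2 then 1 / K else 0 := by
      refine (Finset.sum_le_sum fun T hT => ?_).trans (Finset.sum_le_sum_of_subset_of_nonneg
        (Finset.subset_univ _) fun T _ _ => by split_ifs <;> positivity)
      rw [hPoff S T (Finset.ne_of_mem_erase hT).symm]
      split_ifs
      · exact mul_le_of_le_one_right (by positivity) (min_le_left _ _)
      · exact le_rfl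
    have h2 : ∑ T : {S : Finset (Fin N) // S.card = k ∧ 0 < π S},
        (if (symmDiff S.val T.val).card = 2 then 1 / K else 0) ≤ (k * (N - k) : ℕ) * (1 / K) := by
      rw [← Finset.sum_filter, Finset.sum_const, nsmul_eq_mul]
      refine mul_le_mul_of_nonneg_right ?_ (by positivity)
      refine Nat.cast_le.2 (le_trans ?_ (card_neighbors S.val S.2.1))
      refine Finset.card_le_card_of_injOn Subtype.val ?_ Subtype.val_injective.injOn
      intro T hT
      simp at hT ⊢
      exact ⟨T.2.1, hT⟩
    have h3 : ((k * (N - k) : ℕ) : ℝ) * (1 / K) = 1 / 2 := by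
      push_cast [Nat.cast_sub hkN.le]
      rw [hK]; field_simp
    rw [hPdiag]; linarith
  have hnn : ∀ S T, 0 ≤ P S T := by
    intro S T
    by_cases h : S = T
    · subst h; linarith [hlazy S]
    · exact hnnoff S T h
  have hrow : ∀ S, ∑ T, P S T = 1 := by
    intro S
    rw [← Finset.add_sum_erase _ _ (Finset.mem_univ S), hPdiag S]; ring
  have hrev : ∀ S T : {S : Finset (Fin N) // S.card = k ∧ 0 < π S},
      π S.val * P S T = π T.val * P T S := by
    intro S T
    by_cases h : S = T
    · subst h; rfl
    · rw [hoff S T h, hoff T S (Ne.symm h), symmDiff_comm, min_comm]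
  have hsum1 : ∑ S : {S : Finset (Fin N) // S.card = k ∧ 0 < π S}, π S.val = 1 := by
    rw [hsupp π (fun _ h => h), hπ_sum]
  have hgap : ∀ f : {S : Finset (Fin N) // S.card = k ∧ 0 < π S} → ℝ,
      ∑ x, π x.val * f x = 0 →
      1 / K * ∑ x, π x.val * f x ^ 2 ≤
        1 / 2 * ∑ x, ∑ y, π x.val * P x y * (f x - f y) ^ 2 := by
    intro f hf
    set f' : Finset (Fin N) → ℝ := fun S => if h : S.card = k ∧ 0 < π S then f ⟨S, h⟩ else 0 with hf'
    have hff : ∀ x : {S : Finset (Fin N) // S.card = k ∧ 0 < π S}, f x = f' x.val := by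
      intro x; simp [hf', x.2]
    have q0 : ∑ S, π S * f' S = 0 := by
      rw [← hsupp _ (fun S h => by rw [h, zero_mul])]
      refine Eq.trans (Finset.sum_congr rfl fun x _ => ?_) hf
      rw [hff x]
    have q := poincare hπ_nonneg hk hhom' hLN hπ_sum f' q0
    rw [← hsupp _ (fun S h => by rw [h, zero_mul]), ← hsupp] at q
    · have e1 : ∑ x : {S : Finset (Fin N) // S.card = k ∧ 0 < π S}, π x.val * f x ^ 2 =
          ∑ x : {S : Finset (Fin N) // S.card = k ∧ 0 < π S}, π x.val * f' x.val ^ 2 :=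
        Finset.sum_congr rfl fun x _ => by rw [hff x]
      have e2 : ∑ x : {S : Finset (Fin N) // S.card = k ∧ 0 < π S},
          ∑ y : {S : Finset (Fin N) // S.card = k ∧ 0 < π S}, π x.val * P x y * (f x - f y) ^ 2 =
          1 / K * ∑ x : {S : Finset (Fin N) // S.card = k ∧ 0 < π S},
            ∑ S', if (symmDiff x.val S').card = 2 then
              min (π x.val) (π S') * (f' x.val - f' S') ^ 2 else 0 := by
        rw [Finset.mul_sum]
        refine Finset.sum_congr rfl fun x _ => ?_
        rw [← hsupp, Finset.mul_sum]
        · refine Finset.sum_congr rfl fun y _ => ?_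
          by_cases hxy : x = y
          · subst hxy; simp
          · rw [hoff x y hxy, hff x, hff y]
            split_ifs <;> ring
        · intro S hS
          rw [hS, min_eq_right (hπ_nonneg _)]; simp
      rw [e1, e2]
      have := mul_le_mul_of_nonneg_left q (show 0 ≤ 1 / K by positivity)
      linarith
    · intro S hS
      refine Finset.sum_eq_zero fun S' _ => ?_
      rw [hS, min_eq_left (hπ_nonneg _)]; simp
  have hl1 : 1 / K < 1 := by
    rw [div_lt_one hK0]; linarith
  have hp1 : π X0.val ≤ 1 := by
    rw [← hπ_sum]
    exact Finset.single_le_sum (fun S _ => hπ_nonneg S) (Finset.mem_univ _)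
  have hB0 : 0 ≤ K * (Real.log (π X0.val)⁻¹ + Real.log ε⁻¹) := by
    refine mul_nonneg hK0.le (add_nonneg ?_ ?_)
    · exact Real.log_nonneg (one_le_inv_iff₀.2 ⟨X0.2.2, hp1⟩)
    · exact Real.log_nonneg (one_le_inv_iff₀.2 ⟨hε.1, hε.2.le⟩)
  refine le_trans (Nat.cast_le.2 (Nat.sInf_le (m := ⌊K * (Real.log (π X0.val)⁻¹ + Real.log ε⁻¹)⌋₊) ?_))
    (Nat.floor_le hB0)
  intro t ht
  have ht' : K * (Real.log (π X0.val)⁻¹ + Real.log ε⁻¹) < t + 1 := by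
    refine (Nat.lt_floor_add_one _).trans_le ?_
    have : ((⌊K * (Real.log (π X0.val)⁻¹ + Real.log ε⁻¹)⌋₊ : ℕ) : ℝ) ≤ t := Nat.cast_le.2 ht
    linarith
  exact final_bound K (π X0.val) ε (1 / K) _ t hK2 rfl X0.2.2 hp1 hε.1
    (Finset.sum_nonneg fun _ _ => abs_nonneg _) ht'
    (chain_tv P (fun S => π S.val) (1 / K) hl1 (fun x => x.2.2) hsum1 hrev hrow hnn hlazy hgap X0 t)
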